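/- Every point P on the line through A and M_a has equal power with respect to γ_b and with respect to γ_c; that is, the Gergonne cevian AM_a is the radical axis of γ_b and γ_c. (The power of a point P with respect to a circle with center O and radius ρ is dist(P,O)² − ρ².) -/

import Mathlib

open EuclideanGeometry Real RealInnerProductSpace Affine

/-- The Euclidean plane. -/
abbrev Plane := EuclideanSpace ℝ (Fin 2)

set_option maxHeartbeats 1000000
lemma aux_power (e0 e1 f0 f1 d0 d1 u v a b c r ρ N : ℝ) (ha : 0 < a) (hb : 0 < b) (hc : 0 < c) (hr : 0 < r)
    (ha2 : a^2 = f0^2+f1^2) (hc2 : c^2 = e0^2+e1^2) (hb2 : b^2 = (f0-e0)^2+(f1-e1)^2)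
    (hN : N^2 = (e0*f1-e1*f0)^2) (hNr : N = r*(a+b+c))
    (hd0 : d0 = u*e0+v*f0) (hd1 : d1 = u*e1+v*f1)
    (hu : N*u = ρ*a) (hv : N*v = ρ*c) :
    d0*f0+d1*f1 = a*(ρ*((a+c-b)/2)/r) ∧ d0*e0+d1*e1 = c*(ρ*((a+c-b)/2)/r) ∧
    d0^2+d1^2 = ρ^2+(ρ*((a+c-b)/2)/r)^2 := by
  have hNp : 0 < N := by rw [hNr]; positivity
  obtain ⟨g, hg⟩ : ∃ g, g = e0*f0+e1*f1 := ⟨_, rfl⟩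
  have hg2 : 2*g = a^2+c^2-b^2 := by rw [hg, ha2, hc2, hb2]; ring
  have hNg : N^2 = a^2*c^2-g^2 := by rw [hN, hg, ha2, hc2]; ring
  have hτ : ρ*((a+c-b)/2)/r = ρ*(a*c+g)/N := by
    rw [div_eq_div_iff hr.ne' hNp.ne', hNr]
    linear_combination (-ρ*r/2)*hg2
  rw [hτ]
  have hu' : u = ρ*a/N := by field_simp; linarith
  have hv' : v = ρ*c/N := by field_simp; linarith
  refine ⟨?_, ?_, ?_⟩
  · have : d0*f0+d1*f1 = u*g+v*a^2 := by rw [hd0, hd1, hg, ha2]; ring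
    rw [this, hu', hv']; field_simp; ring
  · have : d0*e0+d1*e1 = u*c^2+v*g := by rw [hd0, hd1, hg, hc2]; ring
    rw [this, hu', hv']; field_simp
  · have : d0^2+d1^2 = u^2*c^2+2*u*v*g+v^2*a^2 := by rw [hd0, hd1, hg, hc2, ha2]; ring
    rw [this, hu', hv']; field_simp
    rw [hNg]; ring

lemma aux_main (e0 e1 f0 f1 d0 d1 u v a b c r ρ N o0 o1 R t0 t1 t s co : ℝ)
    (ha : 0 < a) (hb : 0 < b) (hc : 0 < c) (hr : 0 < r) (hρ : 0 < ρ) (hR : 0 < R)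
    (ha2 : a^2 = f0^2+f1^2) (hc2 : c^2 = e0^2+e1^2) (hb2 : b^2 = (f0-e0)^2+(f1-e1)^2)
    (hN : N = |e0*f1-e1*f0|) (hNr : N = r*(a+b+c)) (hy' : 0 ≤ a+c-b)
    (hd0 : d0 = u*e0+v*f0) (hd1 : d1 = u*e1+v*f1)
    (hu : N*u = ρ*a) (hv : N*v = ρ*c) (huv : u+v ≤ 1)
    (hOA : (o0-e0)^2+(o1-e1)^2 = R^2) (hOC : (o0-f0)^2+(o1-f1)^2 = R^2)
    (hOT : (o0-t0)^2+(o1-t1)^2 = R^2)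
    (hOD : (o0-d0)^2+(o1-d1)^2 = (R+ρ)^2)
    (w : ℝ) (hw : (t0-e0)*(t1-f1)-(t1-e1)*(t0-f0) = w*(e0*f1-e1*f0)) (hw0 : 0 < w)
    (hs : 0 < s) (ht : 0 < t) (hsc : s^2+co^2=1) (hst : s = t*(1+co)) 
    (hang : ((t0-e0)*(t0-f0)+(t1-e1)*(t1-f1))*s = -co*(N*w)) :
    ρ*((a+c-b)/2)/r = (a+c-b)/2 - t*r := by
  have hNp : 0 < N := by rw [hNr]; positivity
  have hN2 : N^2 = (e0*f1-e1*f0)^2 := by rw [hN, sq_abs]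
  obtain ⟨h1, h2, h3⟩ := aux_power e0 e1 f0 f1 d0 d1 u v a b c r ρ N ha hb hc hr ha2 hc2 hb2 hN2 hNr hd0 hd1 hu hv
  obtain ⟨τ, hτ⟩ : ∃ τ, τ = ρ*((a+c-b)/2)/r := ⟨_, rfl⟩
  rw [← hτ] at h1 h2 h3 ⊢
  have hτr : τ*r = ρ*((a+c-b)/2) := by rw [hτ]; field_simp
  obtain ⟨δ, hδ⟩ : ∃ δ, δ = e0*f1-e1*f0 := ⟨_, rfl⟩
  rw [← hδ] at hw hN2
  obtain ⟨l, hl⟩ : ∃ l, l = ((f0-e0)*(o1-(e1+f1)/2)-(f1-e1)*(o0-(e0+f0)/2))/b^2 := ⟨_, rfl⟩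
  have hlb : l*b^2 = ((f0-e0)*(o1-(e1+f1)/2)-(f1-e1)*(o0-(e0+f0)/2)) := by rw [hl]; field_simp
  have hperp : (f0-e0)*(o0-(e0+f0)/2)+(f1-e1)*(o1-(e1+f1)/2) = 0 := by
    linear_combination (hOA-hOC)/2
  have hb2' : b^2 ≠ 0 := by positivity
  have ho0 : o0 = (e0+f0)/2 - l*(f1-e1) := by
    apply mul_right_cancel₀ hb2'
    linear_combination (f1-e1)*hlb + (f0-e0)*hperp + (o0-(e0+f0)/2)*hb2
  have ho1 : o1 = (e1+f1)/2 + l*(f0-e0) := by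
    apply mul_right_cancel₀ hb2'
    linear_combination -(f0-e0)*hlb + (f1-e1)*hperp + (o1-(e1+f1)/2)*hb2
  have hRl : R^2 = b^2/4+l^2*b^2 := by
    rw [← hOA, ho0, ho1, hb2]; ring
  have hT : (t0-e0)*(t0-f0)+(t1-e1)*(t1-f1) = 2*l*δ*w := by
    have : (t0-e0)*(t0-f0)+(t1-e1)*(t1-f1) = 2*l*((t0-e0)*(t1-f1)-(t1-e1)*(t0-f0)) := by
      have h4 := hOT.trans hOA.symm
      rw [ho0, ho1] at h4
      linear_combination h4
    rw [this, hw]; ring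
  have hk : 2*l*δ*s = -co*N := by
    rw [hT] at hang
    apply mul_right_cancel₀ hw0.ne'
    linarith
  have hRs : 2*R*s = b := by
    have h5 : (2*l*s)^2 = co^2 := by
      have : (2*l*s)^2*N^2 = co^2*N^2 := by
        have h6 : (2*l*s)^2*δ^2 = co^2*N^2 := by linear_combination (2*l*δ*s - co*N)*hk
        rw [← hN2] at h6; exact h6
      exact mul_right_cancel₀ (by positivity) this
    have h7 : (2*R*s)^2 = b^2 := by
      linear_combination 4*s^2*hRl + b^2*h5 + b^2*hsc
    exact (pow_left_inj₀ (by positivity) hb.le two_ne_zero).1 h7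
  have hg2 : 2*(e0*f0+e1*f1) = a^2+c^2-b^2 := by rw [ha2, hc2, hb2]; ring
  have hD : τ^2 - (a+c)*τ + (a^2+c^2-b^2)/2 - 2*l*δ*(1-u-v) = 2*R*ρ := by
    have h4 := hOD
    have h8 : (d0-e0)*(d1-f1)-(d1-e1)*(d0-f0) = (1-u-v)*δ := by rw [hd0,hd1,hδ]; ring
    have h9 : (d0-e0)*(d0-f0)+(d1-e1)*(d1-f1) - 2*l*((d0-e0)*(d1-f1)-(d1-e1)*(d0-f0)) = 2*R*ρ+ρ^2 := by
      have h10 := hOA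
      rw [ho0, ho1] at h4 h10
      linear_combination h4 - h10
    rw [h8] at h9
    linear_combination h9 + h1 + h2 - h3 - hg2/2
  have hE : s*(τ^2 - (a+c)*τ + (a^2+c^2-b^2)/2) + co*(N - ρ*(a+c)) = b*ρ := by
    linear_combination s*hD + (1-u-v)*hk + ρ*hRs + co*hu + co*hv
  have hco : 0 < 1+co := (mul_pos_iff_of_pos_left ht).1 (hst ▸ hs)
  have hct : co*(1+t^2) = 1-t^2 := by
    apply mul_right_cancel₀ hco.ne'
    rw [hst] at hsc
    linear_combination hsc
  have hst2 : s*(1+t^2) = 2*t := by rw [hst]; linear_combination t*hct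
  have hE2 : 2*t*(τ^2 - (a+c)*τ + (a^2+c^2-b^2)/2) + (1-t^2)*(N - ρ*(a+c)) = b*ρ*(1+t^2) := by
    linear_combination (1+t^2)*hE - (τ^2 - (a+c)*τ + (a^2+c^2-b^2)/2)*hst2 - (N - ρ*(a+c))*hct
  have hN4 : 4*N^2 = (a+b+c)*(b+c-a)*(a+c-b)*(a+b-c) := by
    have : N^2 = a^2*c^2-(e0*f0+e1*f1)^2 := by rw [hN2, hδ, ha2, hc2]; ring
    rw [this]
    have : e0*f0+e1*f1 = (a^2+c^2-b^2)/2 := by linarith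
    rw [this]; ring
  have hN4' : 4*r*N = (b+c-a)*(a+c-b)*(a+b-c) := by
    apply mul_right_cancel₀ (show a+b+c ≠ 0 by positivity)
    linear_combination hN4 - 4*N*hNr
  have hy : 0 < a+c-b := by
    rcases hy'.lt_or_eq with h | h
    · exact h
    · exfalso
      rw [← h] at hN4
      have : 0 < N^2 := by positivity
      linarith
  have hfac : (τ - (a+c-b)/2 + t*r)*((a+c-b)*t*(τ - (a+b+c)/2) - N) = 0 := by
    rw [hNr] at hN4' hE2 ⊢
    linear_combination ((a+c-b)/2)*hE2 - t/4*hN4' + ((a+c-b)/2*t^2*2- (a+b+c))*hτr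
  have hlt : τ < (a+b+c)/2 := by
    have h11 : ρ*(a+c) ≤ N := by
      have : ρ*(a+c) = N*(u+v) := by linear_combination -hu - hv
      rw [this]
      exact mul_le_of_le_one_right hNp.le huv
    have h12 : τ*r*(a+c) ≤ r*(a+b+c)*((a+c-b)/2) := by
      rw [hτr, ← hNr]
      have := mul_le_mul_of_nonneg_right h11 (show 0 ≤ (a+c-b)/2 by linarith)
      linarith
    have h14 : 0 < r*(a+b+c)*b := by positivity
    have h15 : τ*(r*(a+c)) < (a+b+c)/2*(r*(a+c)) := by linarith
    exact lt_of_mul_lt_mul_right h15 (by positivity)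
  rcases mul_eq_zero.1 hfac with h | h
  · linarith
  · exfalso
    have : (a+c-b)*t*(τ - (a+b+c)/2) < 0 := mul_neg_of_pos_of_neg (by positivity) (by linarith)
    linarith

lemma dsq (P Q : Plane) : dist P Q ^ 2 = (P 0 - Q 0)^2 + (P 1 - Q 1)^2 := by
  rw [EuclideanSpace.dist_eq, Real.sq_sqrt (by positivity)]
  simp [Fin.sum_univ_two, Real.dist_eq, sq_abs]

lemma lmc (P Q : Plane) (m : ℝ) (i : Fin 2) : (AffineMap.lineMap P Q m : Plane) i = P i + m * (Q i - P i) := by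
  simp [AffineMap.lineMap_apply]; ring

lemma infDist_line (X P Q : Plane) (hPQ : P ≠ Q) :
    Metric.infDist X (affineSpan ℝ ({P, Q} : Set Plane) : Set Plane) * dist P Q
      = |(Q 0 - P 0)*(X 1 - P 1) - (Q 1 - P 1)*(X 0 - P 0)| := by
  have hL : 0 < dist P Q := dist_pos.2 hPQ
  have hL2 := dsq P Q
  obtain ⟨L, hLd⟩ : ∃ L, L = dist P Q := ⟨_, rfl⟩
  rw [← hLd] at hL hL2 ⊢
  obtain ⟨k, hk⟩ : ∃ k, k = |(Q 0 - P 0)*(X 1 - P 1) - (Q 1 - P 1)*(X 0 - P 0)| := ⟨_, rfl⟩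
  have hk2 : k^2 = ((Q 0 - P 0)*(X 1 - P 1) - (Q 1 - P 1)*(X 0 - P 0))^2 := by rw [hk, sq_abs]
  have hk0 : 0 ≤ k := by rw [hk]; positivity
  rw [← hk]
  have hne : ((affineSpan ℝ ({P, Q} : Set Plane) : Set Plane)).Nonempty := ⟨P, left_mem_affineSpan_pair ℝ P Q⟩
  apply le_antisymm
  · obtain ⟨m, hm⟩ : ∃ m, m = ((Q 0 - P 0)*(X 0 - P 0)+(Q 1 - P 1)*(X 1 - P 1))/L^2 := ⟨_, rfl⟩
    have hm' : m*L^2 = (Q 0 - P 0)*(X 0 - P 0)+(Q 1 - P 1)*(X 1 - P 1) := by rw [hm]; field_simp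
    have h1 := Metric.infDist_le_dist_of_mem (x := X)
      (AffineMap.lineMap_mem_affineSpan_pair (k := ℝ) m P Q)
    refine (mul_le_mul_of_nonneg_right h1 hL.le).trans (le_of_eq ?_)
    refine (pow_left_inj₀ (by positivity) hk0 two_ne_zero).1 ?_
    rw [mul_pow, dsq, lmc, lmc, hk2]
    linear_combination (m * L^2 - ((Q 0 - P 0)*(X 0 - P 0)+(Q 1 - P 1)*(X 1 - P 1))) * hm' + ((X 0 - P 0)^2+(X 1 - P 1)^2 - m^2*L^2)*hL2 
  · rw [← div_le_iff₀ hL, Metric.le_infDist hne]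
    intro Y hY
    obtain ⟨m, rfl⟩ := mem_affineSpan_pair_iff_exists_lineMap_eq.1 hY
    rw [div_le_iff₀ hL]
    refine (pow_le_pow_iff_left₀ hk0 (by positivity) two_ne_zero).1 ?_
    rw [mul_pow, dsq, lmc, lmc, hk2, hL2]
    nlinarith [sq_nonneg ((Q 0 - P 0)*(X 0 - P 0 - m * (Q 0 - P 0))+(Q 1 - P 1)*(X 1 - P 1 - m * (Q 1 - P 1)))]

lemma hull_wt (A B C X : Plane) (h : X ∈ convexHull ℝ ({A, B, C} : Set Plane)) :
    ∃ α β γ : ℝ, 0 ≤ α ∧ 0 ≤ β ∧ 0 ≤ γ ∧ α + β + γ = 1 ∧ ∀ i, X i = α * A i + β * B i + γ * C i := by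
  have : convexHull ℝ ({A, B, C} : Set Plane) ⊆ {X : Plane | ∃ α β γ : ℝ, 0 ≤ α ∧ 0 ≤ β ∧ 0 ≤ γ ∧ α + β + γ = 1 ∧ ∀ i, X i = α * A i + β * B i + γ * C i} := by
    apply convexHull_min
    · rintro Y (rfl | rfl | rfl)
      · exact ⟨1, 0, 0, by simp⟩
      · exact ⟨0, 1, 0, by simp⟩
      · exact ⟨0, 0, 1, by simp⟩
    · rintro Y ⟨α, β, γ, h1, h2, h3, h4, h5⟩ Z ⟨α', β', γ', h1', h2', h3', h4', h5'⟩ p q hp hq hpq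
      refine ⟨p*α+q*α', p*β+q*β', p*γ+q*γ', by positivity, by positivity, by positivity, ?_, ?_⟩
      · linear_combination p*h4+q*h4'+hpq
      · intro i
        simp [h5, h5']; ring
  exact this h

/-- twice the area -/
noncomputable def cr (A B C : Plane) : ℝ := |(A 0 - B 0)*(C 1 - B 1) - (A 1 - B 1)*(C 0 - B 0)|

lemma cr_rot (A B C : Plane) : cr B C A = cr A B C := by
  unfold cr; congr 1; ring

lemma cr_swap (A B C : Plane) : cr A C B = cr A B C := by
  unfold cr; rw [← abs_neg]; congr 1; ring

lemma wt (A B C X : Plane) (α β γ : ℝ) (hα : 0 ≤ α) (hs : α + β + γ = 1)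
    (hX : ∀ i, X i = α * A i + β * B i + γ * C i) (hBC : B ≠ C) :
    cr A B C * α = Metric.infDist X (affineSpan ℝ ({B, C} : Set Plane) : Set Plane) * dist B C := by
  rw [infDist_line _ _ _ hBC, cr]
  nth_rewrite 1 [← abs_of_nonneg hα]
  rw [← abs_mul, hX, hX, ← abs_neg]
  congr 1
  have : β = 1 - α - γ := by linarith
  rw [this]; ring

lemma interior_wt (A B C X : Plane) (hc : 0 < cr A B C)
    (h : X ∈ interior (convexHull ℝ ({A, B, C} : Set Plane))) :
    ∃ α β γ : ℝ, 0 ≤ α ∧ 0 < β ∧ 0 ≤ γ ∧ α + β + γ = 1 ∧ ∀ i, X i = α * A i + β * B i + γ * C i := by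
  obtain ⟨α, β, γ, h1, h2, h3, h4, h5⟩ := hull_wt A B C X (interior_subset h)
  refine ⟨α, β, γ, h1, ?_, h3, h4, h5⟩
  rcases h2.lt_or_eq with h2 | h2
  · exact h2
  exfalso
  have hcont : Filter.Tendsto (fun s : ℝ => X + s • (A - B)) (nhds 0) (nhds X) := by
    have : Continuous (fun s : ℝ => X + s • (A - B)) := by fun_prop
    simpa using this.tendsto 0
  have hev := hcont.eventually (mem_interior_iff_mem_nhds.1 h)
  obtain ⟨s, hs, hs0⟩ := ((hev.filter_mono (nhdsWithin_le_nhds (s := Set.Ioi 0))).and self_mem_nhdsWithin).exists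
  obtain ⟨α', β', γ', g1, g2, g3, g4, g5⟩ := hull_wt A B C _ hs
  have hs0 : 0 < s := hs0
  have e0 := g5 0
  have e1 := g5 1
  simp [h5, ← h2] at e0 e1
  have hd : (A 0 - B 0)*(C 1 - B 1) - (A 1 - B 1)*(C 0 - B 0) ≠ 0 := by
    intro hh; rw [cr, hh] at hc; simp at hc
  have ha : α = 1 - γ := by linarith
  have ha' : α' = 1 - β' - γ' := by linarith
  have : (β' + s) * ((A 0 - B 0)*(C 1 - B 1) - (A 1 - B 1)*(C 0 - B 0)) = 0 := by
    rw [ha, ha'] at e0 e1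
    linear_combination (C 1 - A 1) * e0 - (C 0 - A 0) * e1
  rcases mul_eq_zero.1 this with h | h
  · linarith
  · exact hd h

lemma center_mem (A B C X : Plane) (ρ : ℝ) (hρ : 0 < ρ)
    (h : Metric.sphere X ρ ⊆ convexHull ℝ ({A, B, C} : Set Plane)) :
    X ∈ convexHull ℝ ({A, B, C} : Set Plane) := by
  let v : Plane := EuclideanSpace.single 0 ρ
  have hv : ‖v‖ = ρ := by simp [v, abs_of_pos hρ]
  have h1 : X + v ∈ convexHull ℝ ({A, B, C} : Set Plane) := h (by simp [hv])
  have h2 : X - v ∈ convexHull ℝ ({A, B, C} : Set Plane) := h (by simp [dist_eq_norm, hv])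
  have := convex_convexHull ℝ ({A, B, C} : Set Plane) h1 h2 (a := 1/2) (b := 1/2) (by norm_num) (by norm_num) (by norm_num)
  convert this using 1
  module

lemma geo_power (A B C X : Plane) (r ρ : ℝ) (hr : 0 < r) (hAB : A ≠ B) (hBC : B ≠ C) (hCA : C ≠ A)
    (hN : cr A B C = r * (dist B C + dist C A + dist A B))
    (hX : X ∈ convexHull ℝ ({A, B, C} : Set Plane))
    (h1 : Metric.infDist X (affineSpan ℝ ({B, C} : Set Plane) : Set Plane) = ρ)
    (h2 : Metric.infDist X (affineSpan ℝ ({B, A} : Set Plane) : Set Plane) = ρ) :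
    (∀ m : ℝ, dist (AffineMap.lineMap B C m : Plane) X ^ 2 - ρ ^ 2 =
      (m * dist B C - ρ*((dist B C + dist A B - dist C A)/2)/r)^2) ∧
    dist A X ^ 2 - ρ ^ 2 = (dist A B - ρ*((dist B C + dist A B - dist C A)/2)/r)^2 := by
  obtain ⟨α, β, γ, g1, g2, g3, g4, g5⟩ := hull_wt A B C X hX
  have hu := wt A B C X α β γ g1 g4 g5 hBC
  have hv := wt C A B X γ α β g3 (by linarith) (fun i => by rw [g5]; ring) hAB
  rw [Set.pair_comm A B, h2, ← cr_rot, ← cr_rot, ← cr_rot, cr_rot, cr_rot] at hv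
  rw [h1] at hu
  have hv : cr A B C * γ = ρ * dist A B := by rw [← cr_rot, ← cr_rot]; convert hv using 2 <;> simp [cr_rot]
  have hβ : β = 1 - α - γ := by linarith
  obtain ⟨k1, k2, k3⟩ := aux_power (A 0 - B 0) (A 1 - B 1) (C 0 - B 0) (C 1 - B 1) (X 0 - B 0) (X 1 - B 1) α γ
    (dist B C) (dist C A) (dist A B) r ρ (cr A B C) (dist_pos.2 hBC) (dist_pos.2 hCA) (dist_pos.2 hAB) hr
    (by rw [dsq]; ring) (by rw [dsq]) (by rw [dsq]; ring) (by rw [cr, sq_abs]) hN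
    (by rw [g5, hβ]; ring) (by rw [g5, hβ]; ring) hu hv
  have e1 := dsq B C
  have e2 := dsq A B
  constructor
  · intro m
    rw [dsq, lmc, lmc]
    linear_combination k3 - 2 * m * k1 - m^2 * e1
  · rw [dsq]
    linear_combination k3 - 2 * k2 - e2

lemma geo_main (A B C X O T : Plane) (r ρ R θ : ℝ) (hr : 0 < r) (hρ : 0 < ρ) (hR : 0 < R)
    (hAB : A ≠ B) (hBC : B ≠ C) (hCA : C ≠ A)
    (hN : cr A B C = r * (dist B C + dist C A + dist A B))
    (hX : X ∈ convexHull ℝ ({A, B, C} : Set Plane))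
    (h1 : Metric.infDist X (affineSpan ℝ ({B, C} : Set Plane) : Set Plane) = ρ)
    (h2 : Metric.infDist X (affineSpan ℝ ({B, A} : Set Plane) : Set Plane) = ρ)
    (hOC : dist C O = R) (hOA : dist A O = R) (hOX : dist O X = R + ρ) (hOT : dist T O = R)
    (hT : T ∈ interior (convexHull ℝ ({A, B, C} : Set Plane)))
    (hθ0 : 0 < θ) (hθ2 : θ < 2 * π) (hang : ∠ C T A = π - θ / 2) :
    ρ*((dist B C + dist A B - dist C A)/2)/r = (dist B C + dist A B - dist C A)/2 - Real.tan (θ / 4) * r := by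
  obtain ⟨α, β, γ, g1, g2, g3, g4, g5⟩ := hull_wt A B C X hX
  have hpa := dist_pos.2 hBC
  have hpb := dist_pos.2 hCA
  have hpc := dist_pos.2 hAB
  have hu := wt A B C X α β γ g1 g4 g5 hBC
  have hv := wt C A B X γ α β g3 (by linarith) (fun i => by rw [g5]; ring) hAB
  rw [Set.pair_comm A B, h2, ← cr_rot, ← cr_rot, ← cr_rot, cr_rot, cr_rot] at hv
  rw [h1] at hu
  have hv : cr A B C * γ = ρ * dist A B := by rw [← cr_rot, ← cr_rot]; convert hv using 2 <;> simp [cr_rot]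
  have hβ : β = 1 - α - γ := by linarith
  have hNp : 0 < cr A B C := by rw [hN]; positivity
  obtain ⟨α', w, γ', k1, k2, k3, k4, k5⟩ := interior_wt A B C T hNp hT
  have hα' : α' = 1 - w - γ' := by linarith
  have hs : 0 < Real.sin (θ/2) := Real.sin_pos_of_pos_of_lt_pi (by linarith) (by linarith)
  have hs4 : 0 < Real.sin (θ/4) := Real.sin_pos_of_pos_of_lt_pi (by linarith) (by linarith)
  have hc4 : 0 < Real.cos (θ/4) := Real.cos_pos_of_mem_Ioo ⟨by linarith, by linarith⟩
  have hw : (T 0 - B 0 - (A 0 - B 0)) * (T 1 - B 1 - (C 1 - B 1)) - (T 1 - B 1 - (A 1 - B 1)) * (T 0 - B 0 - (C 0 - B 0)) = w * ((A 0 - B 0)*(C 1 - B 1) - (A 1 - B 1)*(C 0 - B 0)) := by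
    rw [k5, k5, hα']; ring
  refine aux_main (A 0 - B 0) (A 1 - B 1) (C 0 - B 0) (C 1 - B 1) (X 0 - B 0) (X 1 - B 1) α γ
    (dist B C) (dist C A) (dist A B) r ρ (cr A B C) (O 0 - B 0) (O 1 - B 1) R (T 0 - B 0) (T 1 - B 1)
    (Real.tan (θ/4)) (Real.sin (θ/2)) (Real.cos (θ/2)) hpa hpb hpc hr hρ hR
    (by rw [dsq]; ring) (by rw [dsq]) (by rw [dsq]; ring) rfl hN ?_
    (by rw [g5, hβ]; ring) (by rw [g5, hβ]; ring) hu hv (by linarith)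
    (by rw [← hOA, dsq]; ring) (by rw [← hOC, dsq]; ring) (by rw [← hOT, dsq]; ring)
    (by rw [← hOX, dsq]; ring) w hw k2 hs ?_ (Real.sin_sq_add_cos_sq _) ?_ ?_
  · have := dist_triangle C B A
    rw [dist_comm C B, dist_comm B A] at this
    linarith
  · rw [Real.tan_eq_sin_div_cos]; positivity
  · rw [show θ/2 = 2*(θ/4) by ring, Real.sin_two_mul, Real.cos_two_mul, Real.tan_eq_sin_div_cos]
    field_simp; ring
  · have q1 := InnerProductGeometry.cos_angle_mul_norm_mul_norm (C -ᵥ T) (A -ᵥ T)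
    have q2 := InnerProductGeometry.sin_angle_mul_norm_mul_norm (C -ᵥ T) (A -ᵥ T)
    rw [EuclideanGeometry.angle] at hang
    rw [hang, Real.cos_pi_sub] at q1
    rw [hang, Real.sin_pi_sub] at q2
    have q3 : cr A B C * w = √((inner ℝ (C -ᵥ T) (C -ᵥ T)) * (inner ℝ (A -ᵥ T) (A -ᵥ T)) - (inner ℝ (C -ᵥ T) (A -ᵥ T)) * (inner ℝ (C -ᵥ T) (A -ᵥ T))) := by
      symm
      rw [cr]
      nth_rewrite 1 [← abs_of_pos k2]
      rw [← abs_mul, mul_comm _ w, ← hw, ← Real.sqrt_sq_eq_abs]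
      congr 1
      simp only [PiLp.inner_apply, Fin.sum_univ_two]
      simp
      ring
    have q4 : (T 0 - B 0 - (A 0 - B 0)) * (T 0 - B 0 - (C 0 - B 0)) + (T 1 - B 1 - (A 1 - B 1)) * (T 1 - B 1 - (C 1 - B 1)) = (inner ℝ (C -ᵥ T) (A -ᵥ T)) := by
      simp [PiLp.inner_apply, Fin.sum_univ_two]
      ring
    rw [q4, q3, ← q2, ← q1]; ring

/-- For a general triad of Ajima circles, the Gergonne cevian `A Mₐ` (where `Mₐ` is
the touch point of the incircle with `BC`) is the radical axis of `γ_b` and `γ_c`: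
every point on line `A Mₐ` has equal power with respect to `γ_b` and `γ_c`. -/
theorem gergonne_cevian_radical_axis
    (A B C I O Oa Ob Oc Da Db Dc Ta Tb Tc : Plane)
    (r R p θ t Ra Rb Rc ρa ρb ρc : ℝ)
    (hABC : AffineIndependent ℝ ![A, B, C])
    -- incenter and inradius
    (hr : 0 < r)
    (hIin : I ∈ interior (convexHull ℝ ({A, B, C} : Set Plane)))
    (hIab : Metric.infDist I (affineSpan ℝ ({A, B} : Set Plane) : Set Plane) = r)
    (hIbc : Metric.infDist I (affineSpan ℝ ({B, C} : Set Plane) : Set Plane) = r)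
    (hIca : Metric.infDist I (affineSpan ℝ ({C, A} : Set Plane) : Set Plane) = r)
    -- circumradius
    (hR : 0 < R)
    (hOA : dist A O = R) (hOB : dist B O = R) (hOC : dist C O = R)
    -- semiperimeter
    (hp : p = (dist A B + dist B C + dist C A) / 2)
    -- the common angular measure θ and t = tan(θ/4)
    (hθ0 : 0 < θ) (hθ2 : θ < 2 * π) (ht : t = Real.tan (θ / 4))
    -- the three arcs' circles
    (hRa : 0 < Ra) (hRb : 0 < Rb) (hRc : 0 < Rc)
    (hωaB : dist B Oa = Ra) (hωaC : dist C Oa = Ra)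
    (hωbC : dist C Ob = Rb) (hωbA : dist A Ob = Rb)
    (hωcA : dist A Oc = Rc) (hωcB : dist B Oc = Rc)
    -- the triad circle γ_a
    (hρa : 0 < ρa)
    (hγain : Metric.sphere Da ρa ⊆ convexHull ℝ ({A, B, C} : Set Plane))
    (hγaAB : Metric.infDist Da (affineSpan ℝ ({A, B} : Set Plane) : Set Plane) = ρa)
    (hγaAC : Metric.infDist Da (affineSpan ℝ ({A, C} : Set Plane) : Set Plane) = ρa)
    (hexta : dist Oa Da = Ra + ρa)
    (hTaω : dist Ta Oa = Ra) (hTaγ : dist Ta Da = ρa)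
    (hTaseg : Wbtw ℝ Oa Ta Da)
    (hTain : Ta ∈ interior (convexHull ℝ ({A, B, C} : Set Plane)))
    -- the triad circle γ_b
    (hρb : 0 < ρb)
    (hγbin : Metric.sphere Db ρb ⊆ convexHull ℝ ({A, B, C} : Set Plane))
    (hγbBC : Metric.infDist Db (affineSpan ℝ ({B, C} : Set Plane) : Set Plane) = ρb)
    (hγbBA : Metric.infDist Db (affineSpan ℝ ({B, A} : Set Plane) : Set Plane) = ρb)
    (hextb : dist Ob Db = Rb + ρb)
    (hTbω : dist Tb Ob = Rb) (hTbγ : dist Tb Db = ρb)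
    (hTbseg : Wbtw ℝ Ob Tb Db)
    (hTbin : Tb ∈ interior (convexHull ℝ ({A, B, C} : Set Plane)))
    -- the triad circle γ_c
    (hρc : 0 < ρc)
    (hγcin : Metric.sphere Dc ρc ⊆ convexHull ℝ ({A, B, C} : Set Plane))
    (hγcCA : Metric.infDist Dc (affineSpan ℝ ({C, A} : Set Plane) : Set Plane) = ρc)
    (hγcCB : Metric.infDist Dc (affineSpan ℝ ({C, B} : Set Plane) : Set Plane) = ρc)
    (hextc : dist Oc Dc = Rc + ρc)
    (hTcω : dist Tc Oc = Rc) (hTcγ : dist Tc Dc = ρc)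
    (hTcseg : Wbtw ℝ Oc Tc Dc)
    (hTcin : Tc ∈ interior (convexHull ℝ ({A, B, C} : Set Plane)))
    -- all three arcs have angular measure θ
    (hanga : ∠ B Ta C = π - θ / 2)
    (hangb : ∠ C Tb A = π - θ / 2)
    (hangc : ∠ A Tc B = π - θ / 2)
    (Ma : Plane)
    (hMa : Ma ∈ affineSpan ℝ ({B, C} : Set Plane)) (hMaI : dist I Ma = r) :
    ∀ P : Plane, P ∈ affineSpan ℝ ({A, Ma} : Set Plane) →
      dist P Db ^ 2 - ρb ^ 2 = dist P Dc ^ 2 - ρc ^ 2 := by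
  have hinj := hABC.injective
  have hAB : A ≠ B := fun h => by simpa using hinj.ne (show (0 : Fin 3) ≠ 1 by decide) (by simpa using h)
  have hBC : B ≠ C := fun h => by simpa using hinj.ne (show (1 : Fin 3) ≠ 2 by decide) (by simpa using h)
  have hCA : C ≠ A := fun h => by simpa using hinj.ne (show (2 : Fin 3) ≠ 0 by decide) (by simpa using h)
  have hI := interior_subset hIin
  have hN : cr A B C = r * (dist B C + dist C A + dist A B) := by
    obtain ⟨α, β, γ, g1, g2, g3, g4, g5⟩ := hull_wt A B C I hI
    have w1 := wt A B C I α β γ g1 g4 g5 hBC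
    have w2 := wt B C A I β γ α g2 (by linarith) (fun i => by rw [g5]; ring) hCA
    have w3 := wt C A B I γ α β g3 (by linarith) (fun i => by rw [g5]; ring) hAB
    rw [hIbc] at w1
    rw [hIca, cr_rot] at w2
    rw [hIab, cr_rot B C A, cr_rot] at w3
    linear_combination w1 + w2 + w3 - cr A B C * g4
  have hN' : cr A C B = r * (dist C B + dist B A + dist A C) := by
    rw [cr_swap, hN, dist_comm C B, dist_comm B A, dist_comm A C]; ring
  have hset : ({A, B, C} : Set Plane) = {A, C, B} := by rw [Set.pair_comm B C]
  have mb := center_mem A B C Db ρb hρb hγbin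
  have mc := center_mem A B C Dc ρc hρc hγcin
  rw [hset] at mc hTcin
  have pI := geo_power A B C I r r hr hAB hBC hCA hN hI hIbc (by rw [Set.pair_comm]; exact hIab)
  have pb := geo_power A B C Db r ρb hr hAB hBC hCA hN mb hγbBC hγbBA
  have pc := geo_power A C B Dc r ρc hr hCA.symm hBC.symm hAB.symm hN' mc hγcCB hγcCA
  rw [geo_main A B C Db Ob Tb r ρb Rb θ hr hρb hRb hAB hBC hCA hN mb hγbBC hγbBA hωbC hωbA hextb hTbω hTbin hθ0 hθ2 hangb] at pb
  rw [geo_main A C B Dc Oc Tc r ρc Rc θ hr hρc hRc hCA.symm hBC.symm hAB.symm hN' mc hγcCB hγcCA hωcB hωcA hextc hTcω hTcin hθ0 hθ2 (by rw [EuclideanGeometry.angle_comm]; exact hangc)] at pc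
  obtain ⟨m, rfl⟩ := mem_affineSpan_pair_iff_exists_lineMap_eq.1 hMa
  have hm := pI.1 m
  rw [dist_comm, hMaI, sub_self] at hm
  have hm2 := pow_eq_zero_iff (two_ne_zero) |>.1 hm.symm
  rw [mul_div_cancel_left₀ _ hr.ne'] at hm2
  have fb := pb.1 m
  have fc := pc.1 (1 - m)
  rw [AffineMap.lineMap_apply_one_sub] at fc
  have gb := pb.2
  have gc := pc.2
  rw [dist_comm C B, dist_comm B A, dist_comm A C] at fc
  rw [dist_comm C B, dist_comm B A, dist_comm A C] at gc
  intro P hP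
  obtain ⟨k, rfl⟩ := mem_affineSpan_pair_iff_exists_lineMap_eq.1 hP
  have hA : dist A Db ^ 2 - ρb ^ 2 = dist A Dc ^ 2 - ρc ^ 2 := by
    rw [gb, gc]; ring
  have hM : dist (AffineMap.lineMap B C m : Plane) Db ^ 2 - ρb ^ 2 = dist (AffineMap.lineMap B C m : Plane) Dc ^ 2 - ρc ^ 2 := by
    rw [fb, fc]
    have e1 : m * dist B C = (dist B C + dist A B - dist C A) / 2 := by linarith
    have e2 : (1 - m) * dist B C = (dist B C + dist C A - dist A B) / 2 := by linarith
    rw [e1, e2]; ring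
  generalize (AffineMap.lineMap B C m : Plane) = M at hM ⊢
  rw [dsq, dsq] at hA hM ⊢
  rw [lmc, lmc]
  linear_combination (1 - k) * hA + k * hM
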